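/- arXiv:2203.04840 — 3 statements merged into one kernel-verified Lean document; each statement's English description precedes it below -/
import Mathlib

section
/- For every m ∈ ℕ there exists a constant C > 0, depending only on p, s, γ, m, ρ and φ, such that for every real n ≥ 2, every t ∈ ℝ, every ε > 0 and every multi-index α ∈ ℕ³ with |α| = m, one has ‖∂^α v_nᵉ(t, ·)‖_{L²(ℝ³)} ≤ C κ_n n^{m−s} (1 + (|t| λ_n²)^m) · min(1, 1/(ε n))^{m+3/2}. -/
open MeasureTheory Real ENNReal

noncomputable section

abbrev E3 := EuclideanSpace ℝ (Fin 3)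

/-- Partial derivative in the `i`-th coordinate direction. -/
def pd {F : Type} [NormedAddCommGroup F] [NormedSpace ℝ F] (i : Fin 3) (f : E3 → F) : E3 → F :=
  fun x => fderiv ℝ f x (EuclideanSpace.single i 1)

/-- Iterated partial derivative associated with the multi-index `α : Fin 3 → ℕ`. -/
def pda {F : Type} [NormedAddCommGroup F] [NormedSpace ℝ F] (α : Fin 3 → ℕ) (f : E3 → F) :
    E3 → F :=
  (pd 0)^[α 0] ((pd 1)^[α 1] ((pd 2)^[α 2] f))

/-- The approximate identity `ρ_ε`. -/
def rhoeps (ρ : E3 → ℝ) (ε : ℝ) : E3 → ℝ := fun x => (ε ^ 3)⁻¹ * ρ (ε⁻¹ • x)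

def kap (γ n : ℝ) : ℝ := Real.log n ^ (-γ)

def lam (p : ℕ) (s γ n : ℝ) : ℝ :=
  kap γ n ^ (((p : ℝ) - 1) / 2) * n ^ (((3 : ℝ) / 2 - s) * ((p : ℝ) - 1) / 2)

/-- The bubble `v_n(0,·)`. -/
def bubble (s γ : ℝ) (φ : E3 → ℝ) (n : ℝ) : E3 → ℝ :=
  fun x => kap γ n * n ^ ((3 : ℝ) / 2 - s) * φ (n • x)

/-- Convolution of two real valued functions on `ℝ³`. -/
def convR (f g : E3 → ℝ) : E3 → ℝ :=
  MeasureTheory.convolution f g (ContinuousLinearMap.lsmul ℝ ℝ) volume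

/-- The regularized bubble `v_nᵉ(0,·) = ρ_ε ∗ v_n(0,·)`. -/
def bubbleE (s γ : ℝ) (ρ φ : E3 → ℝ) (n ε : ℝ) : E3 → ℝ :=
  convR (rhoeps ρ ε) (bubble s γ φ n)

/-- The ODE profile `v_nᵉ(t,x) = v_nᵉ(0,x) exp(iσt |v_nᵉ(0,x)|^{p-1})`. -/
def vE (σ : ℝ) (p : ℕ) (s γ : ℝ) (ρ φ : E3 → ℝ) (n ε t : ℝ) : E3 → ℂ :=
  fun x => (bubbleE s γ ρ φ n ε x : ℂ) *
    Complex.exp (Complex.I * σ * t * ((|bubbleE s γ ρ φ n ε x| ^ ((p : ℝ) - 1) : ℝ) : ℂ))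



/-- The function `u` is smooth and its `k`-th derivative is bounded by `B * c k * θ ^ k`. -/
def DerivBound {F : Type} [NormedAddCommGroup F] [NormedSpace ℝ F]
    (c : ℕ → ℝ) (B θ : ℝ) (u : E3 → F) : Prop :=
  ContDiff ℝ (⊤ : ℕ∞) u ∧ ∀ k x, ‖iteratedFDeriv ℝ k u x‖ ≤ B * c k * θ ^ k

section PartialDerivatives

variable {F : Type} [NormedAddCommGroup F] [NormedSpace ℝ F]

lemma contDiff_pd (i : Fin 3) {f : E3 → F} (hf : ContDiff ℝ (⊤ : ℕ∞) f) :
    ContDiff ℝ (⊤ : ℕ∞) (pd i f) :=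
  (hf.fderiv_right (m := (⊤ : ℕ∞)) (by simp)).clm_apply contDiff_const

lemma norm_iteratedFDeriv_pd_le (i : Fin 3) {f : E3 → F} (hf : ContDiff ℝ (⊤ : ℕ∞) f)
    (k : ℕ) (x : E3) :
    ‖iteratedFDeriv ℝ k (pd i f) x‖ ≤ ‖iteratedFDeriv ℝ (k + 1) f x‖ := by
  have hf' : ContDiff ℝ (⊤ : ℕ∞) (fderiv ℝ f) := hf.fderiv_right (by simp)
  have h := norm_iteratedFDeriv_clm_apply_const (c := EuclideanSpace.single i (1 : ℝ))
    (x := x) (n := k) hf'.contDiffAt (by exact_mod_cast le_top)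
  rw [norm_iteratedFDeriv_fderiv] at h
  rw [PiLp.norm_single, norm_one, one_mul] at h
  exact h

lemma iterate_pd_bound (i : Fin 3) {f : E3 → F} (hf : ContDiff ℝ (⊤ : ℕ∞) f) (a : ℕ) :
    ContDiff ℝ (⊤ : ℕ∞) ((pd i)^[a] f) ∧
      ∀ k x, ‖iteratedFDeriv ℝ k ((pd i)^[a] f) x‖ ≤ ‖iteratedFDeriv ℝ (k + a) f x‖ := by
  induction a with
  | zero => exact ⟨hf, fun k x => le_rfl⟩
  | succ a ih =>
    rw [Function.iterate_succ_apply']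
    refine ⟨contDiff_pd i ih.1, fun k x => (norm_iteratedFDeriv_pd_le i ih.1 k x).trans ?_⟩
    exact (ih.2 (k + 1) x).trans_eq (by rw [add_right_comm, add_assoc])

lemma norm_pda_le {f : E3 → F} (hf : ContDiff ℝ (⊤ : ℕ∞) f) (α : Fin 3 → ℕ) (x : E3) :
    ‖pda α f x‖ ≤ ‖iteratedFDeriv ℝ (α 0 + α 1 + α 2) f x‖ := by
  have h2 := iterate_pd_bound 2 hf (α 2)
  have h1 := iterate_pd_bound 1 h2.1 (α 1)
  have h0 := iterate_pd_bound 0 h1.1 (α 0)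
  have h := (h0.2 0 x).trans ((h1.2 _ x).trans (h2.2 _ x))
  rw [norm_iteratedFDeriv_zero, zero_add] at h
  exact h

end PartialDerivatives

section Convolution

lemma norm_iteratedFDeriv_convolution_le {f : E3 → ℝ} (hf : Integrable f) (k : ℕ) :
    ∀ {F : Type} [NormedAddCommGroup F] [NormedSpace ℝ F] [CompleteSpace F] {g : E3 → F},
      ContDiff ℝ (⊤ : ℕ∞) g → HasCompactSupport g → ∀ {M : ℝ},
      (∀ x, ‖iteratedFDeriv ℝ k g x‖ ≤ M) → ∀ x,
      ‖iteratedFDeriv ℝ k (convolution f g (ContinuousLinearMap.lsmul ℝ ℝ) volume) x‖ ≤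
        (∫ y, ‖f y‖) * M := by
  induction k with
  | zero =>
    intro F _ _ _ g _ _ M hM x
    simp only [norm_iteratedFDeriv_zero] at hM ⊢
    rw [convolution_def, ← integral_mul_const]
    refine norm_integral_le_of_norm_le (hf.norm.mul_const M) (.of_forall fun y => ?_)
    simp only [ContinuousLinearMap.lsmul_apply, norm_smul]
    exact mul_le_mul_of_nonneg_left (hM _) (norm_nonneg _)
  | succ k ih =>
    intro F _ _ _ g hg hgs M hM x
    rw [← norm_iteratedFDeriv_fderiv]
    have hd : fderiv ℝ (convolution f g (ContinuousLinearMap.lsmul ℝ ℝ) volume) =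
        convolution f (fderiv ℝ g) (ContinuousLinearMap.lsmul ℝ ℝ) volume := by
      funext z
      rw [(hgs.hasFDerivAt_convolution_right (ContinuousLinearMap.lsmul ℝ ℝ)
        hf.locallyIntegrable (hg.of_le (by exact_mod_cast le_top)) z).fderiv]
      simp only [convolution_def]
      congr 1
    rw [hd]
    exact ih (hg.fderiv_right (by simp)) (hgs.fderiv ℝ)
      (fun y => by rw [norm_iteratedFDeriv_fderiv]; exact hM y) x

lemma exists_iteratedFDeriv_bound {f : E3 → ℝ} (hf : ContDiff ℝ (⊤ : ℕ∞) f)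
    (hfs : HasCompactSupport f) :
    ∃ c : ℕ → ℝ, (∀ k, 0 ≤ c k) ∧ ∀ k x, ‖iteratedFDeriv ℝ k f x‖ ≤ c k := by
  have h : ∀ k, ∃ C, ∀ x, ‖iteratedFDeriv ℝ k f x‖ ≤ C := fun k =>
    (hf.continuous_iteratedFDeriv (m := k) (by exact_mod_cast le_top)).bounded_above_of_compact_support
      (hfs.iteratedFDeriv k)
  choose c hc using h
  exact ⟨c, fun k => (norm_nonneg _).trans (hc k 0), hc⟩

/-- The amplitude-`a`, frequency-`b` rescaling of `f`. -/
def rescale (a b : ℝ) (f : E3 → ℝ) : E3 → ℝ := fun x => a * f (b • x)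

variable {f : E3 → ℝ} {a b : ℝ}

lemma contDiff_rescale (hf : ContDiff ℝ (⊤ : ℕ∞) f) :
    ContDiff ℝ (⊤ : ℕ∞) (rescale a b f) :=
  contDiff_const.mul (hf.comp (contDiff_const_smul b))

lemma norm_iteratedFDeriv_rescale_le (hf : ContDiff ℝ (⊤ : ℕ∞) f) (ha : 0 ≤ a) (hb : 0 ≤ b)
    {k : ℕ} {M : ℝ} (hM : ∀ x, ‖iteratedFDeriv ℝ k f x‖ ≤ M) (x : E3) :
    ‖iteratedFDeriv ℝ k (rescale a b f) x‖ ≤ a * (b ^ k * M) := by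
  have hfk : ContDiff ℝ k f := hf.of_le (by exact_mod_cast le_top)
  have h : rescale a b f = a • (fun x => f (b • x)) := rfl
  have hs : ContDiff ℝ k (fun x => f (b • x)) := hfk.comp (contDiff_const_smul b)
  rw [h, iteratedFDeriv_const_smul_apply hs.contDiffAt, norm_smul,
    iteratedFDeriv_comp_const_smul b hfk, norm_smul, norm_pow, Real.norm_of_nonneg ha,
    Real.norm_of_nonneg hb]
  gcongr
  exact hM _

lemma hasCompactSupport_rescale (hf : HasCompactSupport f) (hb : b ≠ 0) :
    HasCompactSupport (rescale a b f) :=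
  (hf.comp_smul hb).mul_left (f := fun _ => a)

lemma integral_norm_rescale (hf : ∀ x, 0 ≤ f x) (ha : 0 ≤ a) (hb : 0 < b) :
    ∫ x, ‖rescale a b f x‖ = a * ((b ^ 3)⁻¹ * ∫ x, f x) := by
  have h : ∀ x, ‖rescale a b f x‖ = a * f (b • x) := fun x =>
    Real.norm_of_nonneg (mul_nonneg ha (hf _))
  simp_rw [h]
  rw [integral_const_mul, Measure.integral_comp_smul_of_nonneg volume f b (hR := hb.le)]
  simp

lemma norm_le_of_rescale_ne_zero {R : ℝ} (hf : tsupport f ⊆ Metric.closedBall 0 R) (hb : 0 < b)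
    {x : E3} (hx : rescale a b f x ≠ 0) : ‖x‖ ≤ R / b := by
  have h := hf (subset_tsupport f (right_ne_zero_of_mul hx : f (b • x) ≠ 0))
  rw [mem_closedBall_zero_iff, norm_smul, Real.norm_of_nonneg hb.le] at h
  rwa [le_div_iff₀ hb, mul_comm]

end Convolution

section Products

variable {A : Type} [NormedRing A] [NormedAlgebra ℝ A] {B B' θ : ℝ}

lemma DerivBound.mul {c d : ℕ → ℝ} {u v : E3 → A} (hu : DerivBound c B θ u)
    (hv : DerivBound d B' θ v) :
    DerivBound (fun k => ∑ i ∈ Finset.range (k + 1), (k.choose i : ℝ) * c i * d (k - i))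
      (B * B') θ (fun x => u x * v x) := by
  refine ⟨hu.1.mul hv.1, fun k x => ?_⟩
  refine (norm_iteratedFDeriv_mul_le hu.1 hv.1 x (by exact_mod_cast le_top)).trans ?_
  rw [Finset.mul_sum, Finset.sum_mul]
  refine Finset.sum_le_sum fun i hi => ?_
  have hik : i + (k - i) = k := by grind
  calc (k.choose i : ℝ) * ‖iteratedFDeriv ℝ i u x‖ * ‖iteratedFDeriv ℝ (k - i) v x‖
      ≤ (k.choose i : ℝ) * (B * c i * θ ^ i) * (B' * d (k - i) * θ ^ (k - i)) := by
        have hi0 := (norm_nonneg _).trans (hu.2 i x)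
        gcongr
        · exact hu.2 i x
        · exact hv.2 (k - i) x
    _ = B * B' * ((k.choose i : ℝ) * c i * d (k - i)) * (θ ^ i * θ ^ (k - i)) := by ring
    _ = _ := by rw [← pow_add, hik]

lemma DerivBound.mono_right {F : Type} [NormedAddCommGroup F] [NormedSpace ℝ F] {c : ℕ → ℝ}
    {θ' : ℝ} {u : E3 → F} (hu : DerivBound c B θ u) (hB : 0 ≤ B) (hc : ∀ k, 0 ≤ c k)
    (hθ : 0 ≤ θ) (h : θ ≤ θ') : DerivBound c B θ' u :=
  ⟨hu.1, fun k x => (hu.2 k x).trans (by have := hc k; gcongr)⟩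

lemma exists_derivBound_pow (c : ℕ → ℝ) (q : ℕ) :
    ∃ c' : ℕ → ℝ, ∀ (B θ : ℝ) (u : E3 → ℝ), DerivBound c B θ u →
      DerivBound c' (B ^ q) θ (fun x => u x ^ q) := by
  induction q with
  | zero =>
    refine ⟨fun k => if k = 0 then 1 else 0, fun B θ u _ => ⟨by simp [contDiff_const], ?_⟩⟩
    intro k x
    rcases eq_or_ne k 0 with rfl | hk
    · simp
    · simp [hk, iteratedFDeriv_const_of_ne hk]
  | succ q ih =>
    obtain ⟨c', hc'⟩ := ih
    refine ⟨fun k => ∑ i ∈ Finset.range (k + 1), (k.choose i : ℝ) * c' i * c (k - i),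
      fun B θ u hu => ?_⟩
    simp only [pow_succ]
    exact (hc' B θ u hu).mul hu

lemma iteratedDeriv_cexp_I_mul (k : ℕ) :
    iteratedDeriv k (fun r : ℝ => Complex.exp (Complex.I * r)) =
      fun r : ℝ => Complex.I ^ k * Complex.exp (Complex.I * r) := by
  induction k with
  | zero => simp
  | succ k ih =>
    rw [iteratedDeriv_succ, ih]
    funext r
    have h : HasDerivAt (fun r : ℝ => Complex.exp (Complex.I * r))
        (Complex.exp (Complex.I * r) * (Complex.I * 1)) r :=
      ((Complex.ofRealCLM.hasDerivAt (x := r)).const_mul Complex.I).cexp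
    rw [(h.const_mul (Complex.I ^ k)).deriv]
    ring

lemma norm_iteratedFDeriv_cexp_I_mul (k : ℕ) (r : ℝ) :
    ‖iteratedFDeriv ℝ k (fun r : ℝ => Complex.exp (Complex.I * r)) r‖ = 1 := by
  rw [norm_iteratedFDeriv_eq_norm_iteratedDeriv, iteratedDeriv_cexp_I_mul, norm_mul, norm_pow,
    Complex.norm_I, one_pow, mul_comm Complex.I, Complex.norm_exp_ofReal_mul_I, mul_one]

lemma exists_derivBound_cexp (c : ℕ → ℝ) :
    ∃ d : ℕ → ℝ, ∀ (B θ τ : ℝ) (w : E3 → ℝ), 0 ≤ B → 0 ≤ θ → DerivBound c B θ w →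
      DerivBound d 1 ((1 + |τ| * B) * θ)
        (fun x => Complex.exp (Complex.I * ((τ * w x : ℝ) : ℂ))) := by
  let K : ℕ → ℝ := fun k => 1 + ∑ i ∈ Finset.range (k + 1), |c i|
  have hK : ∀ k, 1 ≤ K k := fun k =>
    le_add_of_nonneg_right (Finset.sum_nonneg fun _ _ => abs_nonneg _)
  have hcK : ∀ k i, i ≤ k → c i ≤ K k := fun k i hi => by
    have h := Finset.single_le_sum (f := fun i => |c i|) (fun _ _ => abs_nonneg _)
      (Finset.mem_range.2 (Nat.lt_succ_of_le hi))
    have := le_abs_self (c i)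
    simp only [K]
    linarith
  refine ⟨fun k => k.factorial * K k ^ k, fun B θ τ w hB hθ hw => ?_⟩
  have hE : ContDiff ℝ (⊤ : ℕ∞) (fun r : ℝ => Complex.exp (Complex.I * r)) :=
    (contDiff_const.mul Complex.ofRealCLM.contDiff).cexp
  have hh : ContDiff ℝ (⊤ : ℕ∞) (fun x => τ * w x) := contDiff_const.mul hw.1
  refine ⟨hE.comp hh, fun k x => ?_⟩
  have hT : 0 ≤ |τ| * B := by positivity
  have key := norm_iteratedFDeriv_comp_le hE hh (n := k) (by exact_mod_cast le_top) x (C := 1)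
    (D := K k * ((1 + |τ| * B) * θ)) (fun i _ => (norm_iteratedFDeriv_cexp_I_mul i _).le) ?_
  · refine key.trans_eq ?_
    rw [mul_pow]
    ring
  · intro i hi hik
    have hs : (fun x => τ * w x) = τ • w := rfl
    rw [hs, iteratedFDeriv_const_smul_apply
      (hw.1.of_le (by exact_mod_cast le_top)).contDiffAt, norm_smul, Real.norm_eq_abs]
    calc |τ| * ‖iteratedFDeriv ℝ i w x‖ ≤ |τ| * (B * c i * θ ^ i) := by
          gcongr
          exact hw.2 i x
      _ = |τ| * B * c i * θ ^ i := by ring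
      _ ≤ |τ| * B * K k * θ ^ i := by
          gcongr
          exact hcK k i hik
      _ ≤ (1 + |τ| * B) * K k * θ ^ i := by
          have := hK k
          gcongr
          linarith
      _ ≤ (1 + |τ| * B) ^ i * K k ^ i * θ ^ i := by
          have := hK k
          gcongr
          · exact le_self_pow₀ (by linarith) (by omega)
          · exact le_self_pow₀ this (by omega)
      _ = (K k * ((1 + |τ| * B) * θ)) ^ i := by
          rw [mul_pow, mul_pow]
          ring

lemma DerivBound.ofReal {c : ℕ → ℝ} {u : E3 → ℝ} (hu : DerivBound c B θ u) :
    DerivBound c B θ (fun x => (u x : ℂ)) := by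
  refine ⟨Complex.ofRealCLM.contDiff.comp hu.1, fun k x => ?_⟩
  have h := Complex.ofRealLI.norm_iteratedFDeriv_comp_left (x := x) (n := (⊤ : ℕ∞)) (i := k)
    hu.1.contDiffAt (by exact_mod_cast le_top)
  exact h.trans_le (hu.2 k x)

end Products

lemma eLpNorm_two_le_of_closedBall {f : E3 → ℂ} {M r : ℝ} (hr : 0 ≤ r)
    (hf : ∀ x, ‖f x‖ ≤ M) (hs : Function.support f ⊆ Metric.closedBall 0 r) :
    eLpNorm f 2 volume ≤ ENNReal.ofReal
      (M * r ^ ((3 : ℝ) / 2) * volume.real (Metric.closedBall (0 : E3) 1) ^ ((1 : ℝ) / 2)) := by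
  have hM : 0 ≤ M := (norm_nonneg _).trans (hf 0)
  rw [← eLpNorm_restrict_eq_of_support_subset hs]
  refine (eLpNorm_le_of_ae_bound (.of_forall hf)).trans_eq ?_
  rw [Measure.restrict_apply_univ, Measure.addHaar_closedBall' volume (0 : E3) hr,
    ← ofReal_measureReal (measure_closedBall_lt_top.ne), ← ENNReal.ofReal_mul (by positivity),
    ENNReal.ofReal_rpow_of_nonneg (by positivity) (by simp), ← ENNReal.ofReal_mul (by positivity),
    Real.mul_rpow (by positivity) (by positivity)]
  congr 1
  rw [← Real.rpow_natCast, ← Real.rpow_mul hr]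
  norm_num
  ring

lemma kap_nonneg {γ n : ℝ} (hn : 1 ≤ n) : 0 ≤ kap γ n :=
  Real.rpow_nonneg (Real.log_nonneg hn) _

lemma lam_sq {p : ℕ} (hp : 1 ≤ p) {s γ n : ℝ} (hn : 1 ≤ n) :
    lam p s γ n ^ 2 = (kap γ n * n ^ ((3 : ℝ) / 2 - s)) ^ (p - 1) := by
  have hn0 : 0 ≤ n := by linarith
  have hκ := kap_nonneg (γ := γ) hn
  rw [lam, mul_pow, mul_pow]
  congr 1
  · rw [← Real.rpow_natCast, ← Real.rpow_mul hκ, ← Real.rpow_natCast, Nat.cast_sub hp]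
    congr 1
    push_cast
    ring
  · rw [← Real.rpow_natCast, ← Real.rpow_mul hn0, ← Real.rpow_natCast, ← Real.rpow_mul hn0,
      Nat.cast_sub hp]
    congr 1
    push_cast
    ring

lemma exists_derivBound_convR_rescale {ρ φ : E3 → ℝ}
    (hρ_smooth : ContDiff ℝ (⊤ : ℕ∞) ρ) (hρ_supp : HasCompactSupport ρ)
    (hρ_nonneg : ∀ x, 0 ≤ ρ x) (hρ_int : ∫ x, ρ x = 1)
    (hφ_smooth : ContDiff ℝ (⊤ : ℕ∞) φ) (hφ_supp : tsupport φ ⊆ Metric.closedBall 0 1)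
    (hφ_nonneg : ∀ x, 0 ≤ φ x) :
    ∃ c : ℕ → ℝ, (∀ k, 0 ≤ c k) ∧ ∃ R : ℝ, 0 ≤ R ∧ ∀ a n ε : ℝ, 0 ≤ a → 0 < n → 0 < ε →
      DerivBound c (a * min 1 (1 / (ε * n)) ^ 3) (n * min 1 (1 / (ε * n)))
        (convR (rescale (ε ^ 3)⁻¹ ε⁻¹ ρ) (rescale a n φ)) ∧
      Function.support (convR (rescale (ε ^ 3)⁻¹ ε⁻¹ ρ) (rescale a n φ)) ⊆
        Metric.closedBall 0 (R / (n * min 1 (1 / (ε * n)))) := by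
  have hφ_cpt : HasCompactSupport φ :=
    HasCompactSupport.of_support_subset_isCompact (isCompact_closedBall 0 1)
      ((subset_tsupport φ).trans hφ_supp)
  obtain ⟨cρ, hcρ0, hcρ⟩ := exists_iteratedFDeriv_bound hρ_smooth hρ_supp
  obtain ⟨cφ, hcφ0, hcφ⟩ := exists_iteratedFDeriv_bound hφ_smooth hφ_cpt
  obtain ⟨R, hR0, hR⟩ := hρ_supp.isCompact.isBounded.subset_closedBall_lt 0 0
  have hI : 0 ≤ ∫ x, φ x := integral_nonneg hφ_nonneg
  refine ⟨fun k => cφ k + (∫ x, φ x) * cρ k,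
    fun k => add_nonneg (hcφ0 k) (mul_nonneg hI (hcρ0 k)), R + 1, by linarith, ?_⟩
  intro a n ε ha hn hε
  have hρs : ContDiff ℝ (⊤ : ℕ∞) (rescale (ε ^ 3)⁻¹ ε⁻¹ ρ) := contDiff_rescale hρ_smooth
  have hφs : ContDiff ℝ (⊤ : ℕ∞) (rescale a n φ) := contDiff_rescale hφ_smooth
  have hρc : HasCompactSupport (rescale (ε ^ 3)⁻¹ ε⁻¹ ρ) :=
    hasCompactSupport_rescale hρ_supp (inv_ne_zero hε.ne')
  have hφc : HasCompactSupport (rescale a n φ) := hasCompactSupport_rescale hφ_cpt hn.ne'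
  have hρi := hρs.continuous.integrable_of_hasCompactSupport (μ := volume) hρc
  have hφi := hφs.continuous.integrable_of_hasCompactSupport (μ := volume) hφc
  refine ⟨⟨hφc.contDiff_convolution_right _ hρi.locallyIntegrable hφs, fun k x => ?_⟩, ?_⟩
  · rcases le_total (ε * n) 1 with h | h
    · have h1 : min 1 (1 / (ε * n)) = 1 := min_eq_left ((one_le_div (by positivity)).2 h)
      have hb := norm_iteratedFDeriv_convolution_le hρi k hφs hφc
        (norm_iteratedFDeriv_rescale_le hφ_smooth ha hn.le (hcφ k)) x
      rw [integral_norm_rescale hρ_nonneg (by positivity) (by positivity), hρ_int] at hb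
      rw [h1]
      refine hb.trans ?_
      have h2 : (ε ^ 3)⁻¹ * (((ε⁻¹) ^ 3)⁻¹ * 1) = 1 := by field_simp
      rw [h2, one_pow, one_mul, mul_one, mul_one, mul_comm (n ^ k), ← mul_assoc]
      gcongr
      exact le_add_of_nonneg_right (mul_nonneg hI (hcρ0 k))
    · have h1 : min 1 (1 / (ε * n)) = 1 / (ε * n) :=
        min_eq_right ((div_le_one (by positivity)).2 h)
      have hflip : convR (rescale (ε ^ 3)⁻¹ ε⁻¹ ρ) (rescale a n φ) =
          convolution (rescale a n φ) (rescale (ε ^ 3)⁻¹ ε⁻¹ ρ)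
            (ContinuousLinearMap.lsmul ℝ ℝ) volume := by
        rw [convR, ← convolution_flip]
        congr 1
        ext
        simp
      have hb := norm_iteratedFDeriv_convolution_le hφi k hρs hρc
        (norm_iteratedFDeriv_rescale_le hρ_smooth (by positivity) (by positivity) (hcρ k)) x
      rw [integral_norm_rescale hφ_nonneg ha hn] at hb
      rw [h1, hflip]
      refine hb.trans ?_
      have h2 : n * (1 / (ε * n)) = ε⁻¹ := by field_simp
      have h3 : a * ((n ^ 3)⁻¹ * ∫ x, φ x) * ((ε ^ 3)⁻¹ * (ε⁻¹ ^ k * cρ k)) =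
          a * (1 / (ε * n)) ^ 3 * ((∫ x, φ x) * cρ k) * ε⁻¹ ^ k := by
        rw [one_div, mul_inv]
        ring
      rw [h2, h3]
      gcongr
      exact le_add_of_nonneg_left (hcφ0 k)
  · intro x hx
    obtain ⟨y, hy, z, hz, rfl⟩ := support_convolution_subset _ hx
    have hy' := norm_le_of_rescale_ne_zero hR (inv_pos.2 hε) hy
    have hz' := norm_le_of_rescale_ne_zero hφ_supp hn hz
    set M := min 1 (1 / (ε * n)) with hM
    have hM0 : 0 < M := lt_min one_pos (by positivity)
    have hM1 : n * M ≤ n := mul_le_of_le_one_right hn.le (min_le_left _ _)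
    have hM2 : n * M ≤ ε⁻¹ :=
      (mul_le_mul_of_nonneg_left (min_le_right _ _) hn.le).trans_eq (by field_simp)
    rw [mem_closedBall_zero_iff, add_div]
    refine (norm_add_le y z).trans (add_le_add (hy'.trans ?_) (hz'.trans ?_))
    · gcongr
    · gcongr

lemma exists_derivBound_profile {c : ℕ → ℝ} (hc : ∀ k, 0 ≤ c k) (q : ℕ) :
    ∃ d : ℕ → ℝ, ∀ (B θ τ : ℝ) (u : E3 → ℝ), 0 ≤ B → 0 ≤ θ → DerivBound c B θ u →
      DerivBound d B ((1 + |τ| * B ^ q) * θ)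
        (fun x => (u x : ℂ) * Complex.exp (Complex.I * ((τ * u x ^ q : ℝ) : ℂ))) := by
  obtain ⟨c', hc'⟩ := exists_derivBound_pow c q
  obtain ⟨d, hd⟩ := exists_derivBound_cexp c'
  refine ⟨fun k => ∑ i ∈ Finset.range (k + 1), (k.choose i : ℝ) * c i * d (k - i),
    fun B θ τ u hB hθ hu => ?_⟩
  have h1 : θ ≤ (1 + |τ| * B ^ q) * θ :=
    le_mul_of_one_le_left hθ (le_add_of_nonneg_right (by positivity))
  have h := (hu.ofReal.mono_right hB hc hθ h1).mul
    (hd (B ^ q) θ τ _ (by positivity) hθ (hc' B θ u hu))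
  rwa [mul_one] at h

lemma vE_eq {p : ℕ} (hp_odd : Odd p) (σ s γ : ℝ) (ρ φ : E3 → ℝ) (n ε t : ℝ) :
    vE σ p s γ ρ φ n ε t = fun x => (bubbleE s γ ρ φ n ε x : ℂ) *
      Complex.exp (Complex.I * ((σ * t * bubbleE s γ ρ φ n ε x ^ (p - 1) : ℝ) : ℂ)) := by
  funext x
  have hp1 : ((p : ℝ) - 1) = ((p - 1 : ℕ) : ℝ) := by
    rw [Nat.cast_sub hp_odd.pos, Nat.cast_one]
  have hev : Even (p - 1) := hp_odd.tsub_odd odd_one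
  rw [vE, hp1, Real.rpow_natCast, hev.pow_abs]
  push_cast
  ring_nf

lemma amplitude_identity {κ n M s K d V R : ℝ} (hn : 0 < n) (hM : 0 < M) (hR : 0 ≤ R) (m : ℕ) :
    (κ * n ^ ((3 : ℝ) / 2 - s) * M ^ 3) * d * (K * (n * M)) ^ m *
        (R / (n * M)) ^ ((3 : ℝ) / 2) * V =
      (d * R ^ ((3 : ℝ) / 2) * V) * κ * n ^ ((m : ℝ) - s) * K ^ m * M ^ ((m : ℝ) + 3 / 2) := by
  rw [Real.div_rpow hR (by positivity), Real.mul_rpow hn.le hM.le]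
  have h1 : n ^ ((3 : ℝ) / 2 - s) * n ^ m = n ^ ((m : ℝ) - s) * n ^ ((3 : ℝ) / 2) := by
    rw [← Real.rpow_natCast, ← Real.rpow_add hn, ← Real.rpow_add hn]
    ring_nf
  have h2 : M ^ 3 * M ^ m = M ^ ((m : ℝ) + 3 / 2) * M ^ ((3 : ℝ) / 2) := by
    rw [← pow_add, ← Real.rpow_natCast, ← Real.rpow_add hM]
    push_cast
    ring_nf
  have hn' : n ^ ((3 : ℝ) / 2) ≠ 0 := (Real.rpow_pos_of_pos hn _).ne'
  have hM' : M ^ ((3 : ℝ) / 2) ≠ 0 := (Real.rpow_pos_of_pos hM _).ne'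
  rw [mul_pow, mul_pow]
  calc _ = κ * d * K ^ m * R ^ ((3 : ℝ) / 2) * V * (n ^ ((3 : ℝ) / 2 - s) * n ^ m) *
        (M ^ 3 * M ^ m) / (n ^ ((3 : ℝ) / 2) * M ^ ((3 : ℝ) / 2)) := by ring
    _ = _ := by
      rw [h1, h2]
      field_simp

/-- `L²` bounds on the derivatives of the regularized ODE profile:
for every `m` there is `C > 0` such that for all `n ≥ 2`, `t ∈ ℝ`, `ε > 0` and every
multi-index `α` with `|α| = m`,
`‖∂^α v_nᵉ(t)‖_{L²} ≤ C κ_n n^{m-s} (1 + (|t| λ_n²)^m) min(1, 1/(εn))^{m+3/2}`. -/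
theorem stmt0
    (σ : ℝ) (hσ : σ = 1 ∨ σ = -1)
    (p : ℕ) (hp_odd : Odd p) (hp : 3 ≤ p)
    (s : ℝ) (hs0 : 0 < s) (hs32 : s < 3 / 2)
    (γ : ℝ) (hγ0 : 0 < γ) (hγ1 : γ < 1)
    (ρ : E3 → ℝ) (hρ_smooth : ContDiff ℝ (⊤ : ℕ∞) ρ) (hρ_supp : HasCompactSupport ρ)
    (hρ_nonneg : ∀ x, 0 ≤ ρ x) (hρ_le : ∀ x, ρ x ≤ 1) (hρ_int : ∫ x, ρ x = 1)
    (φ : E3 → ℝ) (hφ_smooth : ContDiff ℝ (⊤ : ℕ∞) φ)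
    (hφ_supp : tsupport φ ⊆ Metric.closedBall 0 1)
    (hφ_nonneg : ∀ x, 0 ≤ φ x) (hφ_le : ∀ x, φ x ≤ 1)
    (m : ℕ) :
    ∃ C > 0, ∀ n : ℝ, 2 ≤ n → ∀ t : ℝ, ∀ ε : ℝ, 0 < ε →
      ∀ α : Fin 3 → ℕ, α 0 + α 1 + α 2 = m →
      eLpNorm (pda α (vE σ p s γ ρ φ n ε t)) 2 volume ≤
        ENNReal.ofReal (C * kap γ n * n ^ ((m : ℝ) - s) * (1 + (|t| * lam p s γ n ^ 2) ^ m) *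
          (min 1 (1 / (ε * n))) ^ ((m : ℝ) + 3 / 2)) := by
  obtain ⟨c, hc0, R, hR0, hc⟩ := exists_derivBound_convR_rescale hρ_smooth hρ_supp hρ_nonneg
    hρ_int hφ_smooth hφ_supp hφ_nonneg
  obtain ⟨d, hd⟩ := exists_derivBound_profile hc0 (p - 1)
  set V := volume.real (Metric.closedBall (0 : E3) 1) ^ ((1 : ℝ) / 2) with hV
  have hV0 : 0 ≤ V := by positivity
  have hRp : 0 ≤ R ^ ((3 : ℝ) / 2) := by positivity
  refine ⟨(|d m| * R ^ ((3 : ℝ) / 2) * V) * 2 ^ (m - 1) + 1, by positivity, ?_⟩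
  intro n hn t ε hε α hα
  have hn0 : 0 < n := by linarith
  have hκ : 0 ≤ kap γ n := kap_nonneg (by linarith)
  have hσ' : |σ| = 1 := by rcases hσ with rfl | rfl <;> simp
  obtain ⟨hu, hus⟩ := hc (kap γ n * n ^ ((3 : ℝ) / 2 - s)) n ε (by positivity) hn0 hε
  set M := min 1 (1 / (ε * n)) with hM
  have hM0 : 0 < M := lt_min one_pos (by positivity)
  have hM1 : M ≤ 1 := min_le_left _ _
  set B := kap γ n * n ^ ((3 : ℝ) / 2 - s) * M ^ 3 with hB
  have hB0 : 0 ≤ B := by positivity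
  have hv := hd B (n * M) (σ * t) _ hB0 (by positivity) hu
  have hvE := vE_eq hp_odd σ s γ ρ φ n ε t
  change DerivBound d B _ (fun x => (bubbleE s γ ρ φ n ε x : ℂ) *
    Complex.exp (Complex.I * ((σ * t * bubbleE s γ ρ φ n ε x ^ (p - 1) : ℝ) : ℂ))) at hv
  rw [← hvE] at hv
  have hsupp : tsupport (vE σ p s γ ρ φ n ε t) ⊆ Metric.closedBall 0 (R / (n * M)) := by
    refine closure_minimal (fun x hx => hus ?_) Metric.isClosed_closedBall
    have h := left_ne_zero_of_mul (hx : vE σ p s γ ρ φ n ε t x ≠ 0)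
    exact Complex.ofReal_ne_zero.1 h
  have hle : ∀ x, ‖pda α (vE σ p s γ ρ φ n ε t) x‖ ≤
      ‖iteratedFDeriv ℝ m (vE σ p s γ ρ φ n ε t) x‖ := fun x => hα ▸ norm_pda_le hv.1 α x
  refine (eLpNorm_two_le_of_closedBall (r := R / (n * M)) (by positivity)
    (fun x => (hle x).trans (hv.2 m x)) ?_).trans (ENNReal.ofReal_le_ofReal ?_)
  · intro x hx
    refine hsupp (support_iteratedFDeriv_subset (𝕜 := ℝ) m ?_)
    exact norm_ne_zero_iff.1 ((norm_pos_iff.2 hx).trans_le (hle x)).ne'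
  · rw [amplitude_identity hn0 hM0 hR0]
    have hBq : B ^ (p - 1) ≤ lam p s γ n ^ 2 := by
      rw [lam_sq hp_odd.pos (by linarith)]
      gcongr
      exact mul_le_of_le_one_right (by positivity) (pow_le_one₀ hM0.le hM1)
    have hK : (1 + |σ * t| * B ^ (p - 1)) ^ m ≤
        2 ^ (m - 1) * (1 + (|t| * lam p s γ n ^ 2) ^ m) := by
      rw [abs_mul, hσ', one_mul]
      calc (1 + |t| * B ^ (p - 1)) ^ m ≤ (1 + |t| * lam p s γ n ^ 2) ^ m := by gcongr
        _ ≤ 2 ^ (m - 1) * (1 ^ m + (|t| * lam p s γ n ^ 2) ^ m) :=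
          add_pow_le zero_le_one (by positivity) m
        _ = _ := by rw [one_pow]
    have hP : 0 ≤ 1 + (|t| * lam p s γ n ^ 2) ^ m := by positivity
    calc _ ≤ (|d m| * R ^ ((3 : ℝ) / 2) * V) * kap γ n * n ^ ((m : ℝ) - s) *
          (2 ^ (m - 1) * (1 + (|t| * lam p s γ n ^ 2) ^ m)) * M ^ ((m : ℝ) + 3 / 2) := by
          gcongr
          exact le_abs_self _
      _ = ((|d m| * R ^ ((3 : ℝ) / 2) * V) * 2 ^ (m - 1)) * kap γ n * n ^ ((m : ℝ) - s) *
          (1 + (|t| * lam p s γ n ^ 2) ^ m) * M ^ ((m : ℝ) + 3 / 2) := by ring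
      _ ≤ _ := by
          gcongr
          linarith
end
end

section
/- Assume φ is not identically zero. Then there exists a constant c₀ > 0 such that for every δ ∈ (0, 1/100], ‖ (φ ∗ ρ_δ)^{p−1} ∇(φ ∗ ρ_δ) ‖_{L²(ℝ³)} ≥ c₀, i.e. the quantity (∫_{ℝ³} (φ ∗ ρ_δ)(x)^{2(p−1)} |∇(φ ∗ ρ_δ)(x)|² dx)^{1/2} is bounded below by c₀ uniformly in δ ∈ (0, 1/100]. -/
open MeasureTheory Real ENNReal

noncomputable section

theorem contDiff_rhoeps {ρ : E3 → ℝ} {n : WithTop ℕ∞} (hρ : ContDiff ℝ n ρ) (ε : ℝ) :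
    ContDiff ℝ n (rhoeps ρ ε) :=
  contDiff_const.mul (hρ.comp (contDiff_const_smul ε⁻¹))

theorem hasCompactSupport_rhoeps {ρ : E3 → ℝ} (hρ : HasCompactSupport ρ) {ε : ℝ} (hε : 0 < ε) :
    HasCompactSupport (rhoeps ρ ε) :=
  (hρ.comp_smul (inv_ne_zero hε.ne')).mul_left

theorem support_rhoeps_subset {ρ : E3 → ℝ} {R : ℝ}
    (hρ : Function.support ρ ⊆ Metric.closedBall 0 R) {ε : ℝ} (hε : 0 < ε) :
    Function.support (rhoeps ρ ε) ⊆ Metric.closedBall 0 (ε * R) := by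
  intro x hx
  have h : ε⁻¹ • x ∈ Metric.closedBall (0 : E3) R := hρ (right_ne_zero_of_mul hx)
  rw [mem_closedBall_zero_iff, norm_smul, norm_inv, Real.norm_of_nonneg hε.le,
    inv_mul_le_iff₀ hε] at h
  rwa [mem_closedBall_zero_iff]

theorem integral_rhoeps (ρ : E3 → ℝ) {ε : ℝ} (hε : 0 < ε) :
    ∫ x, rhoeps ρ ε x = ∫ x, ρ x := by
  unfold rhoeps
  rw [integral_const_mul, Measure.integral_comp_inv_smul_of_nonneg volume ρ hε.le]
  simp [hε.ne']

open scoped Pointwise in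
theorem support_convR_subset (f g : E3 → ℝ) :
    Function.support (convR f g) ⊆ Function.support f + Function.support g :=
  support_convolution_subset _

theorem integral_convR {f g : E3 → ℝ} (hf : Integrable f) (hg : Integrable g) :
    ∫ x, convR f g x = (∫ x, f x) * ∫ x, g x :=
  integral_convolution _ hf hg

theorem contDiff_convR {f g : E3 → ℝ} {n : ℕ∞} (hf : LocallyIntegrable f)
    (hg : HasCompactSupport g) (hg' : ContDiff ℝ n g) : ContDiff ℝ n (convR f g) :=
  hg.contDiff_convolution_right _ hf hg'

theorem eLpNorm_gradient {u : E3 → ℝ} (q : ℝ≥0∞) (k : ℕ) (c : ℝ) :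
    eLpNorm (fun x => (c * u x ^ k) • fderiv ℝ u x) q volume =
      ‖c‖ₑ * eLpNorm (fun x => u x ^ k • gradient u x) q volume := by
  rw [← eLpNorm_const_smul]
  refine eLpNorm_congr_norm_ae (.of_forall fun x => ?_)
  simp [gradient, norm_smul, mul_assoc]

theorem fderiv_fun_pow_eq {u : E3 → ℝ} (hu : ContDiff ℝ 1 u) (p : ℕ) :
    fderiv ℝ (fun x => u x ^ p) = fun x => ((p : ℝ) * u x ^ (p - 1)) • fderiv ℝ u x := by
  ext1 x
  rw [fderiv_fun_pow p (hu.differentiable one_ne_zero x)]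
  simp

/-- Hölder's inequality bounds `∫ |u|` by the `L¹` norm of `u ^ p`. -/
theorem eLpNorm_one_pow_le {u : E3 → ℝ} {s : Set E3} (hu : Continuous u)
    (hs : Function.support u ⊆ s) {p : ℕ} (hp : 1 ≤ p) :
    eLpNorm u 1 volume ^ p ≤
      eLpNorm (fun x => u x ^ p) 1 volume * (volume s ^ (1 - 1 / (p : ℝ))) ^ p := by
  have hp0 : (0 : ℝ) < p := by exact_mod_cast hp
  have holder := eLpNorm_le_eLpNorm_mul_rpow_measure_univ (μ := volume.restrict s) (f := u)
    (p := 1) (q := (p : ℝ≥0∞)) (by exact_mod_cast hp) hu.aestronglyMeasurable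
  rw [eLpNorm_restrict_eq_of_support_subset hs, eLpNorm_restrict_eq_of_support_subset hs] at holder
  have hpow : eLpNorm (fun x => u x ^ p) 1 volume = eLpNorm u p volume ^ p := by
    have h := eLpNorm_norm_rpow (p := 1) (μ := volume) u hp0
    simp only [Real.rpow_natCast, ENNReal.rpow_natCast, one_mul, ENNReal.ofReal_natCast] at h
    rw [← h]
    exact eLpNorm_congr_norm_ae (.of_forall fun x => by simp)
  rw [hpow, ← mul_pow]
  refine pow_le_pow_left' (holder.trans_eq ?_) p
  simp

/-- A quantitative lower bound on `‖u ^ (p - 1) ∇u‖_{L²}`, uniform among functions supported in a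
fixed bounded set with a given lower bound on the integral. -/
theorem exists_pos_le_eLpNorm_pow_smul_gradient {s : Set E3} (hs : Bornology.IsBounded s)
    {p : ℕ} (hp : 1 ≤ p) {m : ℝ} (hm : 0 < m) :
    ∃ c > 0, ∀ u : E3 → ℝ, ContDiff ℝ 1 u → Function.support u ⊆ s → m ≤ ∫ x, u x →
      ENNReal.ofReal c ≤ eLpNorm (fun x => u x ^ (p - 1) • gradient u x) 2 volume := by
  set A : ℝ≥0∞ := eLpNormLESNormFDerivOfLeConst ℝ (volume : Measure E3) s 2 1 * p *
    (volume s ^ (1 - 1 / (p : ℝ))) ^ p with hA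
  have hexp : (0 : ℝ) ≤ 1 - 1 / p := by
    have : (1 : ℝ) ≤ p := by exact_mod_cast hp
    rw [sub_nonneg, div_le_one (by linarith)]
    exact this
  have hA_top : A ≠ ⊤ := by
    refine ENNReal.mul_ne_top (ENNReal.mul_ne_top coe_ne_top (natCast_ne_top p)) ?_
    exact ENNReal.pow_ne_top (ENNReal.rpow_ne_top_of_nonneg hexp hs.measure_lt_top.ne)
  refine ⟨m ^ p / (A.toReal + 1), by positivity, fun u hu hus hint => ?_⟩
  set N := eLpNorm (fun x => u x ^ (p - 1) • gradient u x) 2 volume with hN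
  have hsob : eLpNorm (fun x => u x ^ p) 1 volume ≤
      eLpNormLESNormFDerivOfLeConst ℝ (volume : Measure E3) s 2 1 * (p * N) := by
    have h := eLpNorm_le_eLpNorm_fderiv_of_le (volume : Measure E3) (hu.pow p)
      (s := s) (p := 2) (q := 1)
      (fun x hx => hus fun h0 => hx (by simp [h0, (by lia : p ≠ 0)]))
      (by norm_num) (by simp; norm_num) (by simp; norm_num) hs
    rw [fderiv_fun_pow_eq hu] at h
    simp only [ENNReal.coe_one, ENNReal.coe_ofNat] at h
    rw [eLpNorm_gradient] at h
    simpa [hN] using h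
  have hm1 : ENNReal.ofReal m ≤ eLpNorm u 1 volume := by
    rw [eLpNorm_one_eq_lintegral_enorm]
    refine (ENNReal.ofReal_le_ofReal (hint.trans (le_abs_self _))).trans ?_
    rw [← Real.norm_eq_abs, ofReal_norm]
    exact enorm_integral_le_lintegral_enorm u
  have key : ENNReal.ofReal (m ^ p) ≤ A * N := by
    calc ENNReal.ofReal (m ^ p) = ENNReal.ofReal m ^ p := ENNReal.ofReal_pow hm.le p
      _ ≤ eLpNorm u 1 volume ^ p := pow_le_pow_left' hm1 p
      _ ≤ eLpNorm (fun x => u x ^ p) 1 volume * (volume s ^ (1 - 1 / (p : ℝ))) ^ p :=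
        eLpNorm_one_pow_le hu.continuous hus hp
      _ ≤ eLpNormLESNormFDerivOfLeConst ℝ (volume : Measure E3) s 2 1 * (p * N) *
          (volume s ^ (1 - 1 / (p : ℝ))) ^ p := by gcongr
      _ = A * N := by rw [hA]; ring
  rcases eq_or_ne N ⊤ with hN_top | hN_top
  · simp [hN_top]
  · refine ENNReal.ofReal_le_of_le_toReal ?_
    rw [div_le_iff₀ (by positivity)]
    have h := (ENNReal.ofReal_le_iff_le_toReal (ENNReal.mul_ne_top hA_top hN_top)).1 key
    rw [ENNReal.toReal_mul] at h
    nlinarith [N.toReal_nonneg]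

/-- If `φ` is not identically zero, then there is `c₀ > 0` such that for all
`δ ∈ (0, 1/100]`, `‖(φ ∗ ρ_δ)^{p-1} ∇(φ ∗ ρ_δ)‖_{L²(ℝ³)} ≥ c₀`. -/
theorem stmt4
    (p : ℕ) (hp_odd : Odd p) (hp : 3 ≤ p)
    (ρ : E3 → ℝ) (hρ_smooth : ContDiff ℝ (⊤ : ℕ∞) ρ) (hρ_supp : HasCompactSupport ρ)
    (hρ_nonneg : ∀ x, 0 ≤ ρ x) (hρ_le : ∀ x, ρ x ≤ 1) (hρ_int : ∫ x, ρ x = 1)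
    (φ : E3 → ℝ) (hφ_smooth : ContDiff ℝ (⊤ : ℕ∞) φ)
    (hφ_supp : tsupport φ ⊆ Metric.closedBall 0 1)
    (hφ_nonneg : ∀ x, 0 ≤ φ x) (hφ_le : ∀ x, φ x ≤ 1)
    (hφ_ne : φ ≠ 0) :
    ∃ c₀ > 0, ∀ δ : ℝ, 0 < δ → δ ≤ 1 / 100 →
      ENNReal.ofReal c₀ ≤
        eLpNorm (fun x => (convR φ (rhoeps ρ δ) x) ^ (p - 1) •
          gradient (convR φ (rhoeps ρ δ)) x) 2 volume := by
  have hφ_compact : HasCompactSupport φ :=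
    (isCompact_closedBall (0 : E3) 1).of_isClosed_subset (isClosed_tsupport φ) hφ_supp
  have hφ_integrable : Integrable φ :=
    hφ_smooth.continuous.integrable_of_hasCompactSupport hφ_compact
  obtain ⟨x₀, hx₀⟩ := Function.ne_iff.1 hφ_ne
  have hm : 0 < ∫ x, φ x :=
    hφ_smooth.continuous.integral_pos_of_hasCompactSupport_nonneg_nonzero hφ_compact hφ_nonneg hx₀
  obtain ⟨R, hR, hρR⟩ := hρ_supp.isCompact.isBounded.subset_closedBall_lt 0 0
  obtain ⟨c, hc, hbound⟩ := exists_pos_le_eLpNorm_pow_smul_gradient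
    (Metric.isBounded_closedBall (x := (0 : E3)) (r := 1 + R)) (by lia : 1 ≤ p) hm
  refine ⟨c, hc, fun δ hδ hδ' => hbound _ ?_ ?_ ?_⟩
  · exact contDiff_convR (n := 1) hφ_integrable.locallyIntegrable
      (hasCompactSupport_rhoeps hρ_supp hδ)
      (contDiff_rhoeps (hρ_smooth.of_le (by exact_mod_cast le_top)) δ)
  · refine (support_convR_subset _ _).trans ?_
    rintro _ ⟨y, hy, z, hz, rfl⟩
    have hy' := hφ_supp (subset_tsupport φ hy)
    have hz' := support_rhoeps_subset ((subset_tsupport ρ).trans hρR) hδ hz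
    rw [mem_closedBall_zero_iff] at hy' hz' ⊢
    exact (norm_add_le y z).trans (add_le_add hy' (hz'.trans (by nlinarith)))
  · rw [integral_convR hφ_integrable, integral_rhoeps ρ hδ, hρ_int, mul_one]
    exact (contDiff_rhoeps hρ_smooth δ).continuous.integrable_of_hasCompactSupport
      (hasCompactSupport_rhoeps hρ_supp hδ)
end
end

section
/- Assume φ is not identically zero. Then there exists a constant c₀ > 0 such that for every δ ∈ (0, 1/100], ‖ (φ ∗ ρ_δ)^{2p−3} |∇(φ ∗ ρ_δ)|² ‖_{L²(ℝ³)} ≥ c₀, i.e. the quantity (∫_{ℝ³} (φ ∗ ρ_δ)(x)^{2(2p−3)} |∇(φ ∗ ρ_δ)(x)|⁴ dx)^{1/2} is bounded below by c₀ uniformly in δ ∈ (0, 1/100]. -/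
open MeasureTheory Real ENNReal

noncomputable section

open Filter Topology Metric Module

/-- The weighted average `∫ ρ(y) ψ(x - δ y) dy`. For `δ > 0` it is the convolution `ψ ∗ ρ_δ`, and
it makes sense down to `δ = 0`. -/
def scaledAverage {F : Type*} [NormedAddCommGroup F] [NormedSpace ℝ F]
    (ρ : E3 → ℝ) (ψ : E3 → F) (δ : ℝ) (x : E3) : F :=
  ∫ y, ρ y • ψ (x - δ • y)

theorem convR_rhoeps (ρ φ : E3 → ℝ) {δ : ℝ} (hδ : 0 < δ) :
    convR φ (rhoeps ρ δ) = scaledAverage ρ φ δ := by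
  funext x
  have h := Measure.integral_comp_inv_smul (volume : Measure E3)
    (fun y => ρ y • φ (x - δ • y)) δ
  have hfr : finrank ℝ E3 = 3 := by simp
  have hδ3 : (0 : ℝ) < δ ^ 3 := by positivity
  rw [hfr, abs_of_pos hδ3] at h
  unfold convR scaledAverage rhoeps
  rw [convolution_lsmul_swap]
  calc ∫ t, φ (x - t) • ((δ ^ 3)⁻¹ * ρ (δ⁻¹ • t))
      = ∫ t, (δ ^ 3)⁻¹ * (ρ (δ⁻¹ • t) • φ (x - δ • δ⁻¹ • t)) := by
        refine integral_congr_ae (Eventually.of_forall fun t => ?_)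
        simp only [smul_inv_smul₀ hδ.ne', smul_eq_mul]
        ring
    _ = ∫ y, ρ y • φ (x - δ • y) := by
        rw [integral_const_mul, h, smul_eq_mul, inv_mul_cancel_left₀ hδ3.ne']

section

variable {F : Type*} [NormedAddCommGroup F] [NormedSpace ℝ F] {ρ : E3 → ℝ} {ψ : E3 → F}

theorem continuous_smul_comp_sub_smul (hρ : Continuous ρ) (hψ : Continuous ψ) (δ : ℝ) (x : E3) :
    Continuous fun y => ρ y • ψ (x - δ • y) := by
  fun_prop

theorem integrable_smul_comp_sub_smul (hρ : Continuous ρ) (hρc : HasCompactSupport ρ)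
    (hψ : Continuous ψ) (δ : ℝ) (x : E3) :
    Integrable fun y => ρ y • ψ (x - δ • y) :=
  (continuous_smul_comp_sub_smul hρ hψ δ x).integrable_of_hasCompactSupport hρc.smul_right

theorem integrable_norm_mul_const (hρ : Continuous ρ) (hρc : HasCompactSupport ρ) (C : ℝ) :
    Integrable fun y => ‖ρ y‖ * C :=
  (hρ.integrable_of_hasCompactSupport hρc).norm.mul_const C

theorem continuous_scaledAverage (hρ : Continuous ρ) (hρc : HasCompactSupport ρ)
    (hψ : Continuous ψ) (hψc : HasCompactSupport ψ) :
    Continuous fun q : ℝ × E3 => scaledAverage ρ ψ q.1 q.2 := by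
  obtain ⟨C, hC⟩ := hψc.exists_bound_of_continuous hψ
  refine continuous_of_dominated (bound := fun y => ‖ρ y‖ * C)
    (fun q => (continuous_smul_comp_sub_smul hρ hψ q.1 q.2).aestronglyMeasurable)
    (fun q => Eventually.of_forall fun y => ?_) (integrable_norm_mul_const hρ hρc C)
    (Eventually.of_forall fun y => by fun_prop)
  rw [norm_smul]
  exact mul_le_mul_of_nonneg_left (hC _) (norm_nonneg _)

theorem hasFDerivAt_scaledAverage (hρ : Continuous ρ) (hρc : HasCompactSupport ρ)
    (hψ : ContDiff ℝ 1 ψ) (hψc : HasCompactSupport ψ) (δ : ℝ) (x : E3) :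
    HasFDerivAt (scaledAverage ρ ψ δ) (scaledAverage ρ (fderiv ℝ ψ) δ x) x := by
  have hψ' : Continuous (fderiv ℝ ψ) := hψ.continuous_fderiv one_ne_zero
  obtain ⟨C, hC⟩ := (hψc.fderiv ℝ).exists_bound_of_continuous hψ'
  refine hasFDerivAt_integral_of_dominated_of_fderiv_le (bound := fun y => ‖ρ y‖ * C)
    (F' := fun x y => ρ y • fderiv ℝ ψ (x - δ • y)) univ_mem
    (Eventually.of_forall fun x =>
      (continuous_smul_comp_sub_smul hρ hψ.continuous δ x).aestronglyMeasurable)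
    (integrable_smul_comp_sub_smul hρ hρc hψ.continuous δ x)
    (continuous_smul_comp_sub_smul hρ hψ' δ x).aestronglyMeasurable
    (Eventually.of_forall fun y z _ => ?_) (integrable_norm_mul_const hρ hρc C)
    (Eventually.of_forall fun y z _ => ?_)
  · rw [norm_smul]
    exact mul_le_mul_of_nonneg_left (hC _) (norm_nonneg _)
  · have h := ((hψ.differentiable one_ne_zero) (z - δ • y)).hasFDerivAt
    exact ((hasFDerivAt_comp_sub (δ • y)).2 h).const_smul (ρ y)

end

section

variable {ρ φ : E3 → ℝ}

theorem exists_scaledAverage_ne_zero (hρ : Continuous ρ) (hρc : HasCompactSupport ρ)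
    (hρ0 : ∀ x, 0 ≤ ρ x) (hρ_ne : ρ ≠ 0) (hφ : Continuous φ) (hφ0 : ∀ x, 0 ≤ φ x)
    (hφ_ne : φ ≠ 0) (δ : ℝ) : ∃ x, scaledAverage ρ φ δ x ≠ 0 := by
  obtain ⟨y₀, hy₀⟩ := Function.ne_iff.1 hρ_ne
  obtain ⟨x₀, hx₀⟩ := Function.ne_iff.1 hφ_ne
  refine ⟨x₀ + δ • y₀, ne_of_gt ?_⟩
  refine (continuous_smul_comp_sub_smul hρ hφ δ _).integral_pos_of_hasCompactSupport_nonneg_nonzero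
    hρc.smul_right (fun y => mul_nonneg (hρ0 y) (hφ0 _)) (x := y₀) ?_
  simpa using And.intro hy₀ hx₀

theorem exists_scaledAverage_eq_zero (hρc : HasCompactSupport ρ) (hφc : HasCompactSupport φ)
    (δ : ℝ) : ∃ x, scaledAverage ρ φ δ x = 0 := by
  have hK : IsCompact ((fun q : E3 × E3 => q.1 + δ • q.2) '' (tsupport φ ×ˢ tsupport ρ)) :=
    (hφc.isCompact.prod hρc.isCompact).image (by fun_prop)
  obtain ⟨x, hx⟩ := (Set.ne_univ_iff_exists_notMem _).1 hK.ne_univ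
  refine ⟨x, integral_eq_zero_of_ae (Eventually.of_forall fun y => ?_)⟩
  by_contra h
  simp only [Pi.zero_apply, smul_eq_mul, mul_eq_zero, not_or] at h
  exact hx ⟨(x - δ • y, y), ⟨subset_tsupport _ h.2, subset_tsupport _ h.1⟩, by simp⟩

end

/-- A differentiable function which vanishes somewhere but not everywhere has a point where
neither it nor its derivative vanishes. -/
theorem exists_ne_zero_and_fderiv_ne_zero {f : E3 → ℝ} (hf : Differentiable ℝ f)
    (h0 : ∃ x, f x = 0) (h1 : ∃ x, f x ≠ 0) : ∃ x, f x ≠ 0 ∧ fderiv ℝ f x ≠ 0 := by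
  by_contra! h
  obtain ⟨a, ha⟩ := h0
  obtain ⟨b, hb⟩ := h1
  have hd : ∀ x, fderiv ℝ (fun x => f x ^ 2) x = 0 := fun x => by
    rw [((hf x).hasFDerivAt.pow 2).fderiv]
    by_cases hx : f x = 0
    · simp [hx]
    · simp [h x hx]
  have := is_const_of_fderiv_eq_zero (hf.pow 2) hd b a
  simp [ha, hb] at this

theorem eventually_ofReal_le_eLpNorm {g : ℝ → E3 → ℝ} (hg : Continuous fun q : ℝ × E3 => g q.1 q.2)
    {δ₀ : ℝ} {x₀ : E3} (h : 0 < g δ₀ x₀) :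
    ∃ c > 0, ∀ᶠ δ in 𝓝 δ₀, ENNReal.ofReal c ≤ eLpNorm (g δ) 2 volume := by
  set a := g δ₀ x₀ / 2 with ha
  have hev : ∀ᶠ q : ℝ × E3 in 𝓝 δ₀ ×ˢ 𝓝 x₀, a < g q.1 q.2 := by
    rw [← nhds_prod_eq]
    exact hg.continuousAt.eventually (lt_mem_nhds (half_lt_self h))
  obtain ⟨P, hP, Q, hQ, hPQ⟩ := eventually_prod_iff.1 hev
  obtain ⟨r, hr, hball⟩ := Metric.eventually_nhds_iff_ball.1 hQ
  set z := eLpNorm ((ball x₀ r).indicator fun _ => a) 2 (volume : Measure E3) with hz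
  have hzpos : 0 < z := by
    rw [hz, eLpNorm_indicator_const measurableSet_ball two_ne_zero ofNat_ne_top]
    refine ENNReal.mul_pos (by simp [ha, h.ne']) ?_
    exact (ENNReal.rpow_pos_of_nonneg (measure_ball_pos _ _ hr) (by simp)).ne'
  obtain ⟨c, -, hc0, hcz⟩ := ENNReal.lt_iff_exists_real_btwn.1 hzpos
  refine ⟨c, ENNReal.ofReal_pos.1 hc0, hP.mono fun δ hδ => hcz.le.trans ?_⟩
  refine eLpNorm_mono fun x => ?_
  by_cases hx : x ∈ ball x₀ r
  · have hlt := hPQ hδ (hball x hx)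
    have ha0 : 0 < a := half_pos h
    simp only [Set.indicator_of_mem hx, Real.norm_eq_abs]
    exact abs_le_abs_of_nonneg ha0.le hlt.le
  · simp [Set.indicator_of_notMem hx]

theorem norm_gradient (f : E3 → ℝ) (x : E3) : ‖gradient f x‖ = ‖fderiv ℝ f x‖ :=
  LinearIsometryEquiv.norm_map _ _

theorem IsCompact.exists_pos_forall_ofReal_le {s : Set ℝ} (hs : IsCompact s) {N : ℝ → ℝ≥0∞}
    (h : ∀ t ∈ s, ∃ c > 0, ∀ᶠ u in 𝓝 t, ENNReal.ofReal c ≤ N u) :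
    ∃ c > 0, ∀ t ∈ s, ENNReal.ofReal c ≤ N t := by
  refine hs.induction_on (p := fun s => ∃ c > 0, ∀ t ∈ s, ENNReal.ofReal c ≤ N t)
    ⟨1, one_pos, by simp⟩ ?_ ?_ ?_
  · rintro s t hst ⟨c, hc, H⟩
    exact ⟨c, hc, fun u hu => H u (hst hu)⟩
  · rintro s t ⟨c, hc, H⟩ ⟨d, hd, K⟩
    refine ⟨min c d, lt_min hc hd, ?_⟩
    rintro u (hu | hu)
    · exact (ENNReal.ofReal_le_ofReal (min_le_left _ _)).trans (H u hu)
    · exact (ENNReal.ofReal_le_ofReal (min_le_right _ _)).trans (K u hu)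
  · intro t ht
    obtain ⟨c, hc, H⟩ := h t ht
    exact ⟨_, mem_nhdsWithin_of_mem_nhds H, c, hc, fun u hu => hu⟩

/-- If `φ` is not identically zero, then there is `c₀ > 0` such that for all
`δ ∈ (0, 1/100]`, `‖(φ ∗ ρ_δ)^{2p-3} |∇(φ ∗ ρ_δ)|²‖_{L²(ℝ³)} ≥ c₀`. -/
theorem stmt5
    (p : ℕ) (hp_odd : Odd p) (hp : 3 ≤ p)
    (ρ : E3 → ℝ) (hρ_smooth : ContDiff ℝ (⊤ : ℕ∞) ρ) (hρ_supp : HasCompactSupport ρ)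
    (hρ_nonneg : ∀ x, 0 ≤ ρ x) (hρ_le : ∀ x, ρ x ≤ 1) (hρ_int : ∫ x, ρ x = 1)
    (φ : E3 → ℝ) (hφ_smooth : ContDiff ℝ (⊤ : ℕ∞) φ)
    (hφ_supp : tsupport φ ⊆ Metric.closedBall 0 1)
    (hφ_nonneg : ∀ x, 0 ≤ φ x) (hφ_le : ∀ x, φ x ≤ 1)
    (hφ_ne : φ ≠ 0) :
    ∃ c₀ > 0, ∀ δ : ℝ, 0 < δ → δ ≤ 1 / 100 →
      ENNReal.ofReal c₀ ≤
        eLpNorm (fun x => (convR φ (rhoeps ρ δ) x) ^ (2 * p - 3) *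
          ‖gradient (convR φ (rhoeps ρ δ)) x‖ ^ 2) 2 volume := by
  have hρ : Continuous ρ := hρ_smooth.continuous
  have hρ_ne : ρ ≠ 0 := by
    rintro rfl
    simp at hρ_int
  have hφc : HasCompactSupport φ :=
    HasCompactSupport.of_support_subset_isCompact (isCompact_closedBall 0 1)
      ((subset_tsupport φ).trans hφ_supp)
  have hφ1 : ContDiff ℝ 1 φ := hφ_smooth.of_le (by exact_mod_cast le_top)
  have hderiv := hasFDerivAt_scaledAverage hρ hρ_supp hφ1 hφc
  let g : ℝ → E3 → ℝ := fun δ x =>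
    scaledAverage ρ φ δ x ^ (2 * p - 3) * ‖gradient (scaledAverage ρ φ δ) x‖ ^ 2
  have hg : Continuous fun q : ℝ × E3 => g q.1 q.2 := by
    simp only [g, norm_gradient, (hderiv _ _).fderiv]
    exact ((continuous_scaledAverage hρ hρ_supp hφ1.continuous hφc).pow _).mul
      ((continuous_scaledAverage hρ hρ_supp (hφ1.continuous_fderiv one_ne_zero)
        (hφc.fderiv ℝ)).norm.pow 2)
  have hpos : ∀ δ, ∃ x, 0 < g δ x := fun δ => by
    obtain ⟨x, hx, hx'⟩ := exists_ne_zero_and_fderiv_ne_zero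
      (fun x => (hderiv δ x).differentiableAt)
      (exists_scaledAverage_eq_zero hρ_supp hφc δ)
      (exists_scaledAverage_ne_zero hρ hρ_supp hρ_nonneg hρ_ne hφ1.continuous hφ_nonneg hφ_ne δ)
    have h0 : 0 ≤ scaledAverage ρ φ δ x :=
      integral_nonneg fun y => mul_nonneg (hρ_nonneg y) (hφ_nonneg _)
    refine ⟨x, mul_pos (pow_pos (h0.lt_of_ne' hx) _) (pow_pos ?_ 2)⟩
    rw [norm_gradient]
    exact norm_pos_iff.2 hx'
  obtain ⟨c, hc, H⟩ := (isCompact_Icc (a := (0 : ℝ)) (b := 1 / 100)).exists_pos_forall_ofReal_le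
    (N := fun δ => eLpNorm (g δ) 2 volume) fun δ _ =>
      let ⟨_, hx⟩ := hpos δ
      eventually_ofReal_le_eLpNorm hg hx
  refine ⟨c, hc, fun δ hδ hδ' => ?_⟩
  rw [convR_rhoeps ρ φ hδ]
  exact H δ ⟨hδ.le, hδ'⟩
end
end
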